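/- Let φ(x,z) be a formula, b ∈ U^{|z|}, A ⊆ U small, and let u ⊆ P(U^{|z|}) be the collection of externally definable sets of sort φ(x,z), i.e., u = {D_{p,φ} : p ∈ S_x(U)} where D_{p,φ} = {a : φ(x,a) ∈ p}. Then the following are equivalent: (1) the formula φ(x,b) does not divide over A; (2) u locally covers the orbit o(b/A). -/

import Mathlib

namespace Paper

open FirstOrder Language Cardinal Set

universe u

variable (L : FirstOrder.Language.{u, u}) (U : Type u) [iS : L.Structure U]

/-- A language consisting of a single `n`-ary relation symbol. -/
def predLang (n : ℕ) : FirstOrder.Language.{u, u} where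
  Functions := fun _ => PEmpty
  Relations := fun m => ULift (PLift (m = n))

/-- The language `L` together with one new `n`-ary relation symbol. -/
def expLang (n : ℕ) : FirstOrder.Language.{u, u} := L.sum (predLang n)

/-- The expansion `⟨U, D⟩` of `U` by a predicate for `D ⊆ U^n`. -/
def expStr {n : ℕ} (D : Set (Fin n → U)) : (expLang L n).Structure U where
  funMap := fun {_} f x =>
    match f with
    | Sum.inl f => Structure.funMap f x
    | Sum.inr f => f.elim
  RelMap := fun {_} r x =>
    match r with
    | Sum.inl r => Structure.RelMap r x
    | Sum.inr h => (x ∘ Fin.cast h.down.down.symm) ∈ D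

/-- Add the elements of `A : Set U` as constants to an arbitrary structure on `U`. -/
def addConsts {L' : FirstOrder.Language.{u, u}} (S : L'.Structure U) (A : Set U) :
    (L'[[↥A]]).Structure U :=
  letI := S
  letI : (constantsOn ↥A).Structure U := constantsOn.structure Subtype.val
  Language.sumStructure _ _ _

/-- Add all elements of `U` as constants to an arbitrary structure on `U`. -/
def addAllConsts {L' : FirstOrder.Language.{u, u}} (S : L'.Structure U) :
    (L'[[U]]).Structure U :=
  letI := S
  letI : (constantsOn U).Structure U := constantsOn.structure id
  Language.sumStructure _ _ _

/-- Realization of a formula with respect to an explicitly given structure. -/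
def FRealize {L' : FirstOrder.Language.{u, u}} (S : L'.Structure U) {α : Type*}
    (φ : L'.Formula α) (v : α → U) : Prop :=
  @Formula.Realize L' U S α φ v

/-- Realization of a sentence with respect to an explicitly given structure. -/
def SentRealize {L' : FirstOrder.Language.{u, u}} (S : L'.Structure U) (φ : L'.Sentence) : Prop :=
  @Sentence.Realize L' U S φ

/-- A structure on `U` is saturated if every type over a parameter set of cardinality `< #U`
which is finitely realized is realized. -/
def IsSatStr {L' : FirstOrder.Language.{u, u}} (S : L'.Structure U) : Prop :=
  ∀ A : Set U, #A < #U → ∀ (m : ℕ) (p : Set ((L'[[↥A]]).Formula (Fin m))),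
    (∀ s : Finset ((L'[[↥A]]).Formula (Fin m)), ↑s ⊆ p →
      ∃ b : Fin m → U, ∀ φ ∈ s, FRealize U (addConsts U S A) φ b) →
    ∃ b : Fin m → U, ∀ φ ∈ p, FRealize U (addConsts U S A) φ b

/-- `D ⊆ U^n` is saturated if the expansion `⟨U, D⟩` is a saturated structure. -/
def SatSet {n : ℕ} (D : Set (Fin n → U)) : Prop :=
  IsSatStr U (expStr L U D)

/-- `⟨U,C⟩ ≡_A ⟨U,D⟩` : the two expansions satisfy the same sentences with parameters in `A`. -/
def EqvOver {n : ℕ} (A : Set U) (C D : Set (Fin n → U)) : Prop :=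
  ∀ φ : ((expLang L n)[[↥A]]).Sentence,
    SentRealize U (addConsts U (expStr L U C) A) φ ↔
      SentRealize U (addConsts U (expStr L U D) A) φ

/-- `e(D/A)`, the class of all `C` with `⟨U,C⟩ ≡_A ⟨U,D⟩`. -/
def eSet {n : ℕ} (A : Set U) (D : Set (Fin n → U)) : Set (Set (Fin n → U)) :=
  {C | EqvOver L U A C D}

/-- The group `Aut(U/A)` of automorphisms of `U` fixing `A` pointwise (as a set). -/
def AutFix (A : Set U) : Set (U ≃[L] U) :=
  {f | ∀ a ∈ A, f a = a}

/-- The image of a set of tuples under an automorphism. -/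
def imgSet {n : ℕ} (f : U ≃[L] U) (D : Set (Fin n → U)) : Set (Fin n → U) :=
  (fun b => ⇑f ∘ b) '' D

/-- The orbit `o(D/A)` of `D` under `Aut(U/A)`. -/
def oSet {n : ℕ} (A : Set U) (D : Set (Fin n → U)) : Set (Set (Fin n → U)) :=
  {C | ∃ f ∈ AutFix L U A, imgSet L U f D = C}

/-- The orbit `o(b/A)` of a tuple `b` under `Aut(U/A)`. -/
def oTuple {n : ℕ} (A : Set U) (b : Fin n → U) : Set (Fin n → U) :=
  {c | ∃ f ∈ AutFix L U A, ⇑f ∘ b = c}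

/-- A family of sets shatters `B` if every subset of `B` is the trace of a member. -/
def Shatters {α : Type*} (u : Set (Set α)) (B : Set α) : Prop :=
  ∀ H ⊆ B, ∃ D ∈ u, D ∩ B = H

/-- A family of sets has finite VC dimension if for some `N` it shatters no `N`-element set. -/
def FiniteVC {α : Type*} (u : Set (Set α)) : Prop :=
  ∃ N : ℕ, ∀ B : Finset α, B.card = N → ¬Shatters u ↑B

/-- `B^{|z|}`, the set of tuples with coordinates in `B`. -/
def tuplesIn {n : ℕ} (B : Set U) : Set (Fin n → U) :=
  {a | ∀ i, a i ∈ B}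

/-- `φ(b, U)`, the set defined by `φ(x,z)` with `x ↦ b`. -/
def phiSet {m n : ℕ} (φ : L.Formula (Fin m ⊕ Fin n)) (b : Fin m → U) :
    Set (Fin n → U) :=
  {a | φ.Realize (Sum.elim b a)}

/-- `D` is approximable by `φ(x,z)` : every finite trace of `D` is the trace of
some instance `φ(b,U)`. -/
def ApproxBy {n : ℕ} (D : Set (Fin n → U)) {m : ℕ} (φ : L.Formula (Fin m ⊕ Fin n)) : Prop :=
  ∀ B : Finset U, ∃ b : Fin m → U,
    phiSet L U φ b ∩ tuplesIn U ↑B = D ∩ tuplesIn U ↑B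

/-- `D` is approximable from below by `φ(x,z)`. -/
def ApproxBelowBy {n : ℕ} (D : Set (Fin n → U)) {m : ℕ}
    (φ : L.Formula (Fin m ⊕ Fin n)) : Prop :=
  ∀ B : Finset U, ∃ b : Fin m → U,
    phiSet L U φ b ∩ tuplesIn U ↑B = D ∩ tuplesIn U ↑B ∧ phiSet L U φ b ⊆ D

/-- `D` is approximable from above by `φ(x,z)`. -/
def ApproxAboveBy {n : ℕ} (D : Set (Fin n → U)) {m : ℕ}
    (φ : L.Formula (Fin m ⊕ Fin n)) : Prop :=
  ∀ B : Finset U, ∃ b : Fin m → U,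
    phiSet L U φ b ∩ tuplesIn U ↑B = D ∩ tuplesIn U ↑B ∧ D ⊆ phiSet L U φ b

def Approximable {n : ℕ} (D : Set (Fin n → U)) : Prop :=
  ∃ (m : ℕ) (φ : L.Formula (Fin m ⊕ Fin n)), ApproxBy L U D φ

def ApproxBelow {n : ℕ} (D : Set (Fin n → U)) : Prop :=
  ∃ (m : ℕ) (φ : L.Formula (Fin m ⊕ Fin n)), ApproxBelowBy L U D φ

def ApproxAbove {n : ℕ} (D : Set (Fin n → U)) : Prop :=
  ∃ (m : ℕ) (φ : L.Formula (Fin m ⊕ Fin n)), ApproxAboveBy L U D φ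

/-- The formula `φ(x, a)` (an `L(U)`-formula in the variables `x`), obtained by
substituting the tuple `a` for the variables `z` in `φ(x,z)`. -/
def instFormula {m n : ℕ} (φ : L.Formula (Fin m ⊕ Fin n)) (a : Fin n → U) :
    (L[[U]]).Formula (Fin m) :=
  ((L.lhomWithConstants U).onFormula φ).subst
    (Sum.elim (fun i => Term.var i) (fun j => (L.con (a j)).term))

/-- A (complete) global type in the variables `x = (x_0, ..., x_{m-1})` : a maximal
finitely realized set of `L(U)`-formulas. -/
def IsGlobalType {m : ℕ} (p : Set ((L[[U]]).Formula (Fin m))) : Prop :=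
  (∀ s : Finset ((L[[U]]).Formula (Fin m)), ↑s ⊆ p →
    ∃ b : Fin m → U, ∀ φ ∈ s, FRealize U (addAllConsts U iS) φ b) ∧
  ∀ φ : (L[[U]]).Formula (Fin m), φ ∈ p ↔ φ.not ∉ p

/-- `D` is externally definable: `D = {a : φ(x,a) ∈ p}` for some global type `p` and
formula `φ(x,z)`. -/
def ExtDefinable {n : ℕ} (D : Set (Fin n → U)) : Prop :=
  ∃ (m : ℕ) (φ : L.Formula (Fin m ⊕ Fin n)) (p : Set ((L[[U]]).Formula (Fin m))),
    IsGlobalType L U p ∧ D = {a | instFormula L U φ a ∈ p}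

/-- A sequence of `n`-tuples is indiscernible with respect to the formulas of a
structure `S` on `U`. -/
def IndiscIn {L' : FirstOrder.Language.{u, u}} (S : L'.Structure U) {n : ℕ} {I : Type*} [LinearOrder I]
    (a : I → Fin n → U) : Prop :=
  ∀ (k : ℕ) (i j : Fin k → I), StrictMono i → StrictMono j →
    ∀ φ : L'.Formula (Fin k × Fin n),
      FRealize U S φ (fun q => a (i q.1) q.2) ↔ FRealize U S φ (fun q => a (j q.1) q.2)

/-- An `A`-indiscernible sequence of `n`-tuples. -/
def IndiscOver {n : ℕ} (A : Set U) {I : Type*} [LinearOrder I] (a : I → Fin n → U) : Prop :=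
  IndiscIn U (addConsts U iS A) a


/-- `D` is Lascar invariant over `A` : `D` is invariant over every small model containing `A`. -/
def LascarInv {n : ℕ} (A : Set U) (D : Set (Fin n → U)) : Prop :=
  ∀ M : L.ElementarySubstructure U, A ⊆ (M : L.Substructure U) →
    #((M : L.Substructure U) : Set U) < #U →
    ∀ f ∈ AutFix L U ((M : L.Substructure U) : Set U), imgSet L U f D = D

/-- The cardinality of the set `L(A)` of formulas with parameters in `A`. -/
def formulaCard (A : Set U) : Cardinal.{u} :=
  #(Σ k : ℕ, (L[[↥A]]).Formula (Fin k))

/-- `u` locally covers `B` (relative to the cardinal `κ`). -/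
def LocallyCovers {α : Type u} (κ : Cardinal.{u}) (u : Set (Set α)) (B : Set α) : Prop :=
  ∀ K : Set α, K ⊆ B → #K = κ → ∀ k : ℕ, ∃ D ∈ u, (k : Cardinal.{u}) ≤ #(↥(K ∩ D))

/-- `φ(x, b)` divides over `A` : for some infinite `K ⊆ o(b/A)` and some `k`,
`{φ(x,c) : c ∈ K}` is `k`-inconsistent. -/
def Divides {m n : ℕ} (φ : L.Formula (Fin m ⊕ Fin n)) (b : Fin n → U) (A : Set U) : Prop :=
  ∃ K : Set (Fin n → U), K ⊆ oTuple L U A b ∧ K.Infinite ∧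
    ∃ k : ℕ, ∀ s : Finset (Fin n → U), ↑s ⊆ K → s.card = k →
      ¬∃ x : Fin m → U, ∀ c ∈ s, φ.Realize (Sum.elim x c)

/-- `C` is pseudo-invariant over `A` : `e(C)` locally covers `o(b/A)` for every `b ∈ C`. -/
def PseudoInv {k : ℕ} (A : Set U) (C : Set (Fin k → U)) : Prop :=
  ∀ b ∈ C, LocallyCovers (#U) (eSet L U (∅ : Set U) C) (oTuple L U A b)

/-- A family `u` of subsets of `U^n` is closed: it is cut out by a set of sentences with a
second-order variable, i.e. sentences of the language expanded by a predicate. -/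
def ClosedFam {n : ℕ} (u : Set (Set (Fin n → U))) : Prop :=
  ∃ p : Set ((expLang L n).Sentence),
    u = {D | ∀ φ ∈ p, SentRealize U (expStr L U D) φ}

/-- `κ` is a Ramsey cardinal : every `2`-coloring of the finite subsets of a set of size `κ`
has a homogeneous set of size `κ`. -/
def IsRamseyCard (κ : Cardinal.{u}) : Prop :=
  ∀ (X : Type u), #X = κ → ∀ c : Finset X → Bool,
    ∃ H : Set X, #H = κ ∧
      ∀ s t : Finset X, ↑s ⊆ H → ↑t ⊆ H → s.card = t.card → c s = c t

/-- The formula `φ(x,z)` is NIP: the family of its instances `φ(a,U)` has finite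
VC dimension. -/
def FormulaNIP {m n : ℕ} (φ : L.Formula (Fin m ⊕ Fin n)) : Prop :=
  FiniteVC {E : Set (Fin n → U) | ∃ b : Fin m → U, E = phiSet L U φ b}

/-- The theory of `U` is NIP: every formula is NIP. -/
def TheoryNIP : Prop :=
  ∀ (m n : ℕ) (φ : L.Formula (Fin m ⊕ Fin n)), FormulaNIP L U φ

/-- A global type `p(z)` is invariant over `A` : each of the sets `D_{p,φ}` is fixed
(setwise) by every automorphism fixing `A` pointwise. -/
def GlobalTypeInv {n : ℕ} (A : Set U) (p : Set ((L[[U]]).Formula (Fin n))) : Prop :=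
  ∀ (k : ℕ) (φ : L.Formula (Fin n ⊕ Fin k)) (f : U ≃[L] U), f ∈ AutFix L U A →
    imgSet L U f {a | instFormula L U φ a ∈ p} = {a | instFormula L U φ a ∈ p}

/-- `M` (a subset of `U`) is `L(A;C)`-saturated : every finitely realized type `p(x) ⊆ L(A;C)`
is realized by a tuple from `M`. -/
def LACSat {n : ℕ} (C : Set (Fin n → U)) (A : Set U) (M : Set U) : Prop :=
  ∀ (m : ℕ) (p : Set (((expLang L n)[[↥A]]).Formula (Fin m))),
    (∀ s : Finset (((expLang L n)[[↥A]]).Formula (Fin m)), ↑s ⊆ p →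
      ∃ b : Fin m → U, ∀ φ ∈ s, FRealize U (addConsts U (expStr L U C) A) φ b) →
    ∃ b : Fin m → U, (∀ i, b i ∈ M) ∧
      ∀ φ ∈ p, FRealize U (addConsts U (expStr L U C) A) φ b

/-- The inclusion of languages `L(M) → L(U)` for `M : Set U`. -/
def liftConsts (M : Set U) : (L[[↥M]]) →ᴸ (L[[U]]) :=
  LHom.sumMap (LHom.id L) (LHom.constantsOnMap Subtype.val)


section Saturation

variable {L : FirstOrder.Language.{u, u}} {U : Type u} [iS : L.Structure U]

/-- Transfinite recursion along a well-order: at each stage choose, when possible, an element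
related by `G` to the set of previously chosen elements. -/
theorem exists_transfinite_choice {I X : Type*} [LinearOrder I] [WellFoundedLT I] [Nonempty X]
    (G : Set X → I → X → Prop) :
    ∃ f : I → X, ∀ i, (∃ x, G (f '' Iio i) i x) → G (f '' Iio i) i (f i) := by
  let F : ∀ i : I, (∀ j, j < i → X) → X := fun i rec =>
    Classical.epsilon (G {x | ∃ j, ∃ h : j < i, rec j h = x} i)
  let f : I → X := (wellFounded_lt (α := I)).fix F
  refine ⟨f, fun i hi => ?_⟩
  have hf : f i = Classical.epsilon (G (f '' Iio i) i) := by
    have hs : f '' Iio i = {x | ∃ j, ∃ _ : j < i, f j = x} := by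
      ext x
      simp
    rw [hs]
    exact (wellFounded_lt (α := I)).fix_eq F i
  rw [hf]
  exact Classical.epsilon_spec hi

/-- Saturation for types over an indexed family of parameters. -/
theorem IsSatStr.exists_realize (hsat : IsSatStr U iS) {J : Type u} (hJ : #J < #U) (g : J → U)
    {m : ℕ} (p : Set (L.Formula (J ⊕ Fin m)))
    (hp : ∀ s : Finset (L.Formula (J ⊕ Fin m)), ↑s ⊆ p →
      ∃ b : Fin m → U, ∀ ψ ∈ s, ψ.Realize (Sum.elim g b)) :
    ∃ b : Fin m → U, ∀ ψ ∈ p, ψ.Realize (Sum.elim g b) := by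
  classical
  let tr : L.Formula (J ⊕ Fin m) → (L[[↥(range g)]]).Formula (Fin m) := fun ψ =>
    BoundedFormula.constantsVarsEquiv.symm (ψ.relabel (Sum.map (rangeFactorization g) id))
  have key : ∀ (ψ : L.Formula (J ⊕ Fin m)) (b : Fin m → U),
      FRealize U (addConsts U iS (range g)) (tr ψ) b ↔ ψ.Realize (Sum.elim g b) := by
    intro ψ b
    have h := BoundedFormula.realize_constantsVarsEquiv (L := L) (α := ↥(range g)) (M := U)
      (φ := tr ψ) (v := b) (xs := default)
    refine h.symm.trans ?_
    simp only [tr, Equiv.apply_symm_apply]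
    refine Formula.realize_relabel.trans ?_
    refine iff_of_eq (congrArg _ ?_)
    funext q
    rcases q with q | q <;> rfl
  obtain ⟨b, hb⟩ := hsat (range g) (mk_range_le.trans_lt hJ) m (tr '' p) (by
    intro s hs
    obtain ⟨t, ht, rfl⟩ := Finset.subset_set_image_iff.1 hs
    obtain ⟨b, hb⟩ := hp t ht
    refine ⟨b, fun ψ hψ => ?_⟩
    obtain ⟨χ, hχ, rfl⟩ := Finset.mem_image.1 hψ
    exact (key χ b).2 (hb χ hχ))
  exact ⟨b, fun ψ hψ => (key ψ b).1 (hb _ ⟨ψ, hψ, rfl⟩)⟩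

variable (L) in
/-- Two families of elements satisfy the same formulas. -/
def SameType {J : Type*} (f g : J → U) : Prop :=
  ∀ ψ : L.Formula J, ψ.Realize f ↔ ψ.Realize g

theorem SameType.symm {J : Type*} {f g : J → U} (h : SameType L f g) : SameType L g f :=
  fun ψ => (h ψ).symm

theorem SameType.comp {J J' : Type*} {f g : J → U} (h : SameType L f g) (e : J' → J) :
    SameType L (f ∘ e) (g ∘ e) := fun ψ => by
  simpa [Formula.realize_relabel] using h (ψ.relabel e)

theorem SameType.exists_extend (hsat : IsSatStr U iS) {J : Type u} (hJ : #J < #U) {f g : J → U}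
    (h : SameType L f g) (a : U) :
    ∃ c, SameType L (Sum.elim f fun _ : Fin 1 => a) (Sum.elim g fun _ : Fin 1 => c) := by
  obtain ⟨c, hc⟩ := hsat.exists_realize hJ g
    {ψ : L.Formula (J ⊕ Fin 1) | ψ.Realize (Sum.elim f fun _ => a)} (by
      intro s hs
      have h1 := (h ((Formula.iInf fun ψ : s => ψ.1).iExs (Fin 1))).1 (by
        rw [Formula.realize_iExs]
        exact ⟨fun _ => a, Formula.realize_iInf.2 fun ψ => hs ψ.2⟩)
      rw [Formula.realize_iExs] at h1
      obtain ⟨c, hc⟩ := h1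
      exact ⟨c, fun ψ hψ => Formula.realize_iInf.1 hc ⟨ψ, hψ⟩⟩)
  have hc0 : c = fun _ => c 0 := by
    funext i
    rw [Subsingleton.elim i 0]
  rw [hc0] at hc
  refine ⟨c 0, fun ψ => ⟨hc ψ, fun hψ => ?_⟩⟩
  by_contra hn
  exact Formula.realize_not.1 (hc ψ.not (Formula.realize_not.2 hn)) hψ

variable (L) in
/-- A set of pairs that, read as a relation, preserves all formulas. -/
def PartialElem (P : Set (U × U)) : Prop :=
  SameType L (fun p : P => p.1.1) (fun p : P => p.1.2)

theorem PartialElem.mono {P Q : Set (U × U)} (h : PartialElem L Q) (hPQ : P ⊆ Q) :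
    PartialElem L P :=
  SameType.comp h (Set.inclusion hPQ)

theorem partialElem_of_finite {P : Set (U × U)}
    (h : ∀ F ⊆ P, F.Finite → PartialElem L F) : PartialElem L P := by
  classical
  intro ψ
  let F : Set (U × U) := Subtype.val '' (ψ.freeVarFinset : Set P)
  let e : ψ.freeVarFinset → F := fun a => ⟨a.1.1, a.1, a.2, rfl⟩
  have h1 := h F (by rintro _ ⟨p, -, rfl⟩; exact p.2) (Finset.finite_toSet _ |>.image _)
    (BoundedFormula.restrictFreeVar ψ e)
  simp only [Formula.Realize] at h1 ⊢
  exact (BoundedFormula.realize_restrictFreeVar (f := e) (fun p : P => p.1.1)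
    fun _ => rfl).symm.trans (h1.trans
      (BoundedFormula.realize_restrictFreeVar (f := e) (fun p : P => p.1.2) fun _ => rfl))

theorem partialElem_insert {P : Set (U × U)} {a c : U}
    (h : SameType L (Sum.elim (fun p : P => p.1.1) fun _ : Fin 1 => a)
      (Sum.elim (fun p : P => p.1.2) fun _ : Fin 1 => c)) :
    PartialElem L (insert (a, c) P) := by
  classical
  let e : ↥(insert (a, c) P) → P ⊕ Fin 1 := fun q =>
    if hq : q.1 ∈ P then Sum.inl ⟨q.1, hq⟩ else Sum.inr 0
  have he : ∀ q : ↥(insert (a, c) P), q.1 ∉ P → q.1 = (a, c) := fun q hq =>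
    q.2.resolve_right hq
  unfold PartialElem
  convert h.comp e using 1
  · funext q
    by_cases hq : q.1 ∈ P
    · simp [e, hq]
    · have hq' : (a, c) ∉ P := he q hq ▸ hq
      simp [e, hq', he q hq]
  · funext q
    by_cases hq : q.1 ∈ P
    · simp [e, hq]
    · have hq' : (a, c) ∉ P := he q hq ▸ hq
      simp [e, hq', he q hq]

theorem PartialElem.exists_insert_left (hsat : IsSatStr U iS) {P : Set (U × U)}
    (h : PartialElem L P) (hP : #P < #U) (a : U) : ∃ c, PartialElem L (insert (a, c) P) :=
  (SameType.exists_extend hsat hP h a).imp fun _ => partialElem_insert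

theorem PartialElem.exists_insert_right (hsat : IsSatStr U iS) {P : Set (U × U)}
    (h : PartialElem L P) (hP : #P < #U) (c : U) : ∃ a, PartialElem L (insert (a, c) P) :=
  (SameType.exists_extend hsat hP h.symm c).imp fun _ ha => partialElem_insert ha.symm

/-- A total and surjective elementary relation is the graph of an automorphism. -/
theorem PartialElem.exists_equiv {P : Set (U × U)} (h : PartialElem L P)
    (hl : ∀ a, ∃ c, (a, c) ∈ P) (hr : ∀ c, ∃ a, (a, c) ∈ P) :
    ∃ F : U ≃[L] U, ∀ p ∈ P, F p.1 = p.2 := by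
  choose F hF using hl
  have heq : ∀ p q : P, p.1.1 = q.1.1 ↔ p.1.2 = q.1.2 := fun p q => by
    simpa [Formula.realize_equal] using h ((Term.var p).equal (Term.var q))
  have hid : SameType L (id : U → U) F := h.comp fun a => (⟨(a, F a), hF a⟩ : P)
  have hval : ∀ p ∈ P, F p.1 = p.2 := fun p hp => (heq ⟨_, hF p.1⟩ ⟨p, hp⟩).1 rfl
  have hbij : Function.Bijective F := by
    refine ⟨fun a a' haa => (heq ⟨_, hF a⟩ ⟨_, hF a'⟩).2 haa, fun c => ?_⟩
    obtain ⟨a, ha⟩ := hr c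
    exact ⟨a, hval _ ha⟩
  refine ⟨{ toEquiv := Equiv.ofBijective F hbij, map_fun' := ?_, map_rel' := ?_ }, hval⟩
  · intro k f x
    have := hid ((Term.func f fun i => Term.var (x i)).equal (Term.var (Structure.funMap f x)))
    simp only [Formula.realize_equal, Term.realize_func, Term.realize_var, id_eq, true_iff] at this
    exact this.symm
  · intro k r x
    have := hid (r.formula fun i => Term.var (x i))
    simp only [Formula.realize_rel, Term.realize_var, id_eq] at this
    exact this.symm

theorem finite_subset_union_image {I X : Type*} [LinearOrder I] {f : I → X} {S : Set I}
    {P F : Set X} (hF : F.Finite) (h : F ⊆ P ∪ f '' S) :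
    F ⊆ P ∨ ∃ j ∈ S, F ⊆ P ∪ f '' Iic j := by
  induction F, hF using Set.Finite.induction_on with
  | empty => exact Or.inl (empty_subset _)
  | @insert x F _ _ ih =>
    rw [insert_subset_iff] at h
    obtain ⟨hx, hF⟩ := h
    have hmono : ∀ {i j : I}, i ≤ j → P ∪ f '' Iic i ⊆ P ∪ f '' Iic j := fun hij =>
      union_subset_union_right _ (image_mono (Iic_subset_Iic.2 hij))
    rcases hx with hx | ⟨i, hi, rfl⟩
    · exact (ih hF).imp (insert_subset hx) fun ⟨j, hj, hFj⟩ =>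
        ⟨j, hj, insert_subset (Or.inl hx) hFj⟩
    · right
      rcases ih hF with hFP | ⟨j, hj, hFj⟩
      · exact ⟨i, hi, insert_subset (Or.inr ⟨i, le_rfl, rfl⟩) (hFP.trans subset_union_left)⟩
      · rcases le_total i j with hij | hij
        · exact ⟨j, hj, insert_subset (Or.inr ⟨i, hij, rfl⟩) hFj⟩
        · exact ⟨i, hi, insert_subset (Or.inr ⟨i, le_rfl, rfl⟩) (hFj.trans (hmono hij))⟩

theorem mk_Iio_ord_lt {c : Cardinal.{u}} (i : c.ord.ToType) : #(Iio i) < c := by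
  simpa using mk_Iio_lt i (by simp)

/-- Saturated structures are strongly homogeneous. -/
theorem PartialElem.exists_equiv_of_isSatStr (hsat : IsSatStr U iS) (hU : ℵ₀ ≤ #U)
    {P : Set (U × U)} (h : PartialElem L P) (hP : #P < #U) :
    ∃ F : U ≃[L] U, ∀ p ∈ P, F p.1 = p.2 := by
  have hne : Nonempty U := by
    rw [← mk_ne_zero_iff]
    exact (aleph0_pos.trans_le hU).ne'
  obtain ⟨e⟩ : Nonempty ((#U).ord.ToType ≃ U ⊕ U) := by
    rw [← Cardinal.eq, mk_ord_toType, ← Cardinal.add_def, add_eq_self hU]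
  obtain ⟨f, hf⟩ := exists_transfinite_choice fun (S : Set (U × U)) i x =>
    PartialElem L (insert x (P ∪ S)) ∧ Sum.elim (fun a => x.1 = a) (fun c => x.2 = c) (e i)
  have hex : ∀ i, PartialElem L (P ∪ f '' Iio i) →
      PartialElem L (insert (f i) (P ∪ f '' Iio i)) ∧
        Sum.elim (fun a => (f i).1 = a) (fun c => (f i).2 = c) (e i) := by
    intro i hi
    have hcard : #↥(P ∪ f '' Iio i) < #U :=
      (mk_union_le _ _).trans_lt (add_lt_of_lt hU hP (mk_image_le.trans_lt (mk_Iio_ord_lt i)))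
    refine hf i ?_
    rcases hei : e i with a | c
    · obtain ⟨c, hc⟩ := hi.exists_insert_left hsat hcard a
      exact ⟨(a, c), hc, rfl⟩
    · obtain ⟨a, ha⟩ := hi.exists_insert_right hsat hcard c
      exact ⟨(a, c), ha, rfl⟩
  have hunion : ∀ S : Set (#U).ord.ToType,
      (∀ j ∈ S, PartialElem L (insert (f j) (P ∪ f '' Iio j))) → PartialElem L (P ∪ f '' S) := by
    intro S hS
    refine partialElem_of_finite fun F hFS hF => ?_
    rcases finite_subset_union_image hF hFS with hF | ⟨j, hj, hF⟩
    · exact h.mono hF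
    · refine (hS j hj).mono (hF.trans ?_)
      rw [← Iio_insert, image_insert_eq, union_insert]
  have hall : ∀ i, PartialElem L (P ∪ f '' Iio i) := by
    intro i
    induction i using WellFoundedLT.induction with
    | _ i ih => exact hunion _ fun j hj => (hex j (ih j hj)).1
  obtain ⟨F, hF⟩ := (hunion univ fun j _ => (hex j (hall j)).1).exists_equiv
    (fun a => by
      have h1 := (hex (e.symm (.inl a)) (hall _)).2
      rw [e.apply_symm_apply] at h1
      exact ⟨(f (e.symm (.inl a))).2, Or.inr ⟨_, mem_univ _, Prod.ext h1 rfl⟩⟩)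
    (fun c => by
      have h1 := (hex (e.symm (.inr c)) (hall _)).2
      rw [e.apply_symm_apply] at h1
      exact ⟨(f (e.symm (.inr c))).1, Or.inr ⟨_, mem_univ _, Prod.ext rfl h1⟩⟩)
  exact ⟨F, fun p hp => hF p (Or.inl hp)⟩

theorem mem_oTuple_of_sameType (hsat : IsSatStr U iS) (hU : ℵ₀ ≤ #U) {n : ℕ} {A : Set U}
    (hA : #A < #U) {b c : Fin n → U}
    (h : SameType L (Sum.elim (Subtype.val : A → U) b) (Sum.elim (Subtype.val : A → U) c)) :
    c ∈ oTuple L U A b := by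
  let pr : A ⊕ Fin n → U × U := fun q => (Sum.elim Subtype.val b q, Sum.elim Subtype.val c q)
  have hpr : ∀ p : range pr, pr p.2.choose = p.1 := fun p => p.2.choose_spec
  have hP : PartialElem L (range pr) := by
    unfold PartialElem
    convert h.comp fun p : range pr => p.2.choose using 1
    · funext p
      exact (congrArg Prod.fst (hpr p)).symm
    · funext p
      exact (congrArg Prod.snd (hpr p)).symm
  have hcard : #(range pr) < #U := by
    refine mk_range_le.trans_lt ?_
    simpa using add_lt_of_lt hU hA (natCast_lt_aleph0.trans_le hU)
  obtain ⟨F, hF⟩ := hP.exists_equiv_of_isSatStr hsat hU hcard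
  exact ⟨F, fun a ha => hF _ ⟨Sum.inl ⟨a, ha⟩, rfl⟩, funext fun i => hF _ ⟨Sum.inr i, rfl⟩⟩

/-- A sequence indexed by `ℕ` can be replaced by one of length `#U` whose finite tuples satisfy
only formulas already satisfied by tuples of distinct members of the original sequence. -/
theorem exists_long_sequence (hsat : IsSatStr U iS) (hU : ℵ₀ < #U) {n : ℕ} {A : Set U}
    (hA : #A < #U) (a : ℕ → Fin n → U) :
    ∃ f : (#U).ord.ToType → Fin n → U,
      (∀ ψ : L.Formula (A ⊕ Fin n), (∀ j, ψ.Realize (Sum.elim Subtype.val (a j))) →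
        ∀ i, ψ.Realize (Sum.elim Subtype.val (f i))) ∧
      ∀ (k : ℕ) (θ : L.Formula (Fin k × Fin n)) (i : Fin k → (#U).ord.ToType), StrictMono i →
        θ.Realize (fun q => f (i q.1) q.2) →
          ∃ j : Fin k → ℕ, Function.Injective j ∧ θ.Realize (fun q => a (j q.1) q.2) := by
  have hne : Nonempty U := by
    rw [← mk_ne_zero_iff]
    exact (aleph0_pos.trans hU).ne'
  let W := Filter.hyperfilter ℕ
  let B : Set (Fin n → U) → Set U := fun S =>
    A ∪ range (fun p : ℕ × Fin n => a p.1 p.2) ∪ range (fun p : S × Fin n => p.1.1 p.2)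
  have hB : ∀ S : Set (Fin n → U), #S < #U → #(B S) < #U := by
    intro S hS
    refine (mk_union_le _ _).trans_lt (add_lt_of_lt hU.le ?_ ?_)
    · refine (mk_union_le _ _).trans_lt (add_lt_of_lt hU.le hA ?_)
      exact (Set.countable_range _).le_aleph0.trans_lt hU
    · refine mk_range_le.trans_lt ?_
      simpa using mul_lt_of_lt hU.le hS (natCast_lt_aleph0.trans hU)
  obtain ⟨f, hf⟩ := exists_transfinite_choice
    fun (S : Set (Fin n → U)) (_ : (#U).ord.ToType) x =>
      ∀ ψ : L.Formula (B S ⊕ Fin n), (∀ᶠ j in (W : Filter ℕ),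
        ψ.Realize (Sum.elim Subtype.val (a j))) → ψ.Realize (Sum.elim Subtype.val x)
  replace hf := fun i => hf i (by
    refine hsat.exists_realize (hB _ (mk_image_le.trans_lt (mk_Iio_ord_lt i))) _
      {ψ | ∀ᶠ j in (W : Filter ℕ), ψ.Realize (Sum.elim Subtype.val (a j))} fun s hs => ?_
    obtain ⟨j, hj⟩ := ((Finset.eventually_all s).2 fun ψ hψ => hs hψ).exists
    exact ⟨a j, hj⟩)
  refine ⟨f, fun ψ hψ i => ?_, fun k θ i hi hθ => ?_⟩
  · let e : A ⊕ Fin n → B (f '' Iio i) ⊕ Fin n :=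
      Sum.map (fun x => ⟨x.1, Or.inl (Or.inl x.2)⟩) id
    have he : ∀ x : Fin n → U, (Sum.elim Subtype.val x : B (f '' Iio i) ⊕ Fin n → U) ∘ e =
        Sum.elim Subtype.val x := fun x => by
      funext q
      rcases q with q | q <;> rfl
    have h1 := hf i (ψ.relabel e) (Filter.Eventually.of_forall fun j => by
      rw [Formula.realize_relabel, he]
      exact hψ j)
    rwa [Formula.realize_relabel, he] at h1
  · have step : ∀ (c : Fin k → Fin n → U) (t : Fin k),
        (∀ r, r ≠ t → ∀ q, c r q ∈ B (f '' Iio (i t))) → c t = f (i t) →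
        θ.Realize (fun q => c q.1 q.2) →
        ∀ᶠ j in (W : Filter ℕ), θ.Realize (fun q => Function.update c t (a j) q.1 q.2) := by
      intro c t hc hct hθc
      let e : Fin k × Fin n → B (f '' Iio (i t)) ⊕ Fin n := fun q =>
        if h : q.1 = t then Sum.inr q.2 else Sum.inl ⟨c q.1 q.2, hc q.1 h q.2⟩
      have he : ∀ x : Fin n → U, (Sum.elim Subtype.val x : B (f '' Iio (i t)) ⊕ Fin n → U) ∘ e =
          fun q => Function.update c t x q.1 q.2 := fun x => by
        funext q
        by_cases hq : q.1 = t
        · simp [e, hq]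
        · simp [e, hq]
      by_contra hn
      have h1 := hf (i t) (θ.not.relabel e) (by
        simpa only [Formula.realize_relabel, he, Formula.realize_not] using
          Ultrafilter.eventually_not.2 hn)
      rw [Formula.realize_relabel, he, ← hct, Function.update_eq_self] at h1
      exact h1 hθc
    have descend : ∀ d t : ℕ, t + d = k → ∃ j : Fin k → ℕ,
        (∀ r s : Fin k, t ≤ r.1 → t ≤ s.1 → j r = j s → r = s) ∧
        θ.Realize (fun q => (if q.1.1 < t then f (i q.1) else a (j q.1)) q.2) := by
      intro d
      induction d with
      | zero =>
        rintro t rfl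
        refine ⟨fun _ => 0, fun r _ hr => absurd hr (by have := r.2; omega), ?_⟩
        simpa using hθ
      | succ d ih =>
        intro t ht
        obtain ⟨j, hj, hθj⟩ := ih (t + 1) (by omega)
        let t' : Fin k := ⟨t, by omega⟩
        have h1 := step (fun r => if r.1 < t + 1 then f (i r) else a (j r)) t'
          (fun r hr q => by
            have hr' : r.1 ≠ t := fun h => hr (Fin.ext h)
            by_cases hrt : r.1 < t + 1
            · rw [if_pos hrt]
              have hlt : r < t' := Fin.lt_def.2 (show r.1 < t by omega)
              exact Or.inr ⟨(⟨f (i r), mem_image_of_mem f (hi hlt)⟩, q), rfl⟩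
            · rw [if_neg hrt]
              exact Or.inl (Or.inr ⟨(j r, q), rfl⟩))
          (if_pos (Nat.lt_succ_self t)) hθj
        have h2 : ∀ᶠ l in (W : Filter ℕ), l ∉ range j :=
          Filter.hyperfilter_le_cofinite (Set.finite_range j).compl_mem_cofinite
        obtain ⟨l, hl, hlj⟩ := (h1.and h2).exists
        refine ⟨Function.update j t' l, fun r s hr hs hrs => ?_, ?_⟩
        · by_cases hrt : r = t' <;> by_cases hst : s = t'
          · rw [hrt, hst]
          · subst hrt
            rw [Function.update_self, Function.update_of_ne hst] at hrs
            exact absurd ⟨s, hrs.symm⟩ hlj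
          · subst hst
            rw [Function.update_self, Function.update_of_ne hrt] at hrs
            exact absurd ⟨r, hrs⟩ hlj
          · rw [Function.update_of_ne hst, Function.update_of_ne hrt] at hrs
            have hrt' : r.1 ≠ t := fun h => hrt (Fin.ext h)
            have hst' : s.1 ≠ t := fun h => hst (Fin.ext h)
            exact hj r s (by omega) (by omega) hrs
        · convert hl using 2 with q
          by_cases hq : q.1 = t'
          · simp [hq, t']
          · have hq' : q.1.1 ≠ t := fun h => hq (Fin.ext h)
            have hiff : q.1.1 < t ↔ q.1.1 < t + 1 := by omega
            simp only [Function.update_of_ne hq, hiff]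
    obtain ⟨j, hj, hθj⟩ := descend k 0 (by omega)
    exact ⟨j, fun r s => hj r s (Nat.zero_le _) (Nat.zero_le _), by simpa using hθj⟩

theorem sameType_of_mem_oTuple {n : ℕ} {A : Set U} {b c : Fin n → U} (h : c ∈ oTuple L U A b) :
    SameType L (Sum.elim (Subtype.val : A → U) b) (Sum.elim (Subtype.val : A → U) c) := by
  obtain ⟨F, hF, rfl⟩ := h
  intro ψ
  have he : Sum.elim (Subtype.val : A → U) (F ∘ b) = F ∘ Sum.elim Subtype.val b := by
    funext q
    rcases q with q | q
    · exact (hF q q.2).symm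
    · rfl
  rw [he]
  exact (StrongHomClass.realize_formula F ψ).symm

/-- Dividing is witnessed by a set of conjugates of full cardinality. -/
theorem Divides.exists_card_eq (hsat : IsSatStr U iS) (hU : ℵ₀ < #U) {m n : ℕ}
    {φ : L.Formula (Fin m ⊕ Fin n)} {b : Fin n → U} {A : Set U} (hA : #A < #U)
    (h : Divides L U φ b A) :
    ∃ K : Set (Fin n → U), K ⊆ oTuple L U A b ∧ #K = #U ∧
      ∃ k : ℕ, ∀ s : Finset (Fin n → U), ↑s ⊆ K → s.card = k →
        ¬∃ x : Fin m → U, ∀ c ∈ s, φ.Realize (Sum.elim x c) := by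
  classical
  obtain ⟨K, hK, hinf, k, hk⟩ := h
  let a : ℕ → Fin n → U := fun j => hinf.natEmbedding K j
  have ha : Function.Injective a :=
    Subtype.val_injective.comp (hinf.natEmbedding K).injective
  have haK : ∀ j, a j ∈ K := fun j => (hinf.natEmbedding K j).2
  obtain ⟨f, hfA, hfa⟩ := exists_long_sequence hsat hU hA a
  have hlt : ∀ i i', i < i' → f i ≠ f i' := by
    intro i i' hii heq
    obtain ⟨j, hj, h1⟩ := hfa 2
      (Formula.iInf fun q : Fin n => (Term.var (0, q)).equal (Term.var (1, q))) ![i, i']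
      (by simpa [Fin.strictMono_iff_lt_succ] using hii)
      (by simp [Formula.realize_equal, heq])
    simp only [Formula.realize_iInf, Formula.realize_equal, Term.realize_var] at h1
    exact absurd (hj (ha (funext h1))) (by decide)
  have hf : Function.Injective f := fun i i' hii => by
    rcases lt_trichotomy i i' with h | h | h
    · exact absurd hii (hlt _ _ h)
    · exact h
    · exact absurd hii.symm (hlt _ _ h)
  refine ⟨range f, ?_, ?_, k, fun s hs hsk hx => ?_⟩
  · rintro _ ⟨i, rfl⟩
    refine mem_oTuple_of_sameType hsat hU.le hA fun ψ => ?_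
    have htype := fun j => sameType_of_mem_oTuple (hK (haK j))
    refine ⟨fun hψ => hfA ψ (fun j => (htype j ψ).1 hψ) i, fun hψ => ?_⟩
    by_contra hn
    exact Formula.realize_not.1 (hfA ψ.not (fun j => (htype j ψ.not).1
      (Formula.realize_not.2 hn)) i) hψ
  · rw [mk_range_eq f hf, mk_ord_toType]
  · obtain ⟨t, -, rfl⟩ := Finset.subset_set_image_iff.1 (image_univ ▸ hs)
    rw [Finset.card_image_of_injective _ hf] at hsk
    obtain ⟨x, hx⟩ := hx
    let θ : L.Formula (Fin k × Fin n) := (Formula.iInf fun r : Fin k =>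
      φ.relabel (Sum.elim Sum.inr fun q => Sum.inl (r, q))).iExs (Fin m)
    have hθ : ∀ c : Fin k → Fin n → U, θ.Realize (fun q => c q.1 q.2) ↔
        ∃ x : Fin m → U, ∀ r, φ.Realize (Sum.elim x (c r)) := by
      intro c
      simp only [θ, Formula.realize_iExs, Formula.realize_iInf, Formula.realize_relabel]
      refine exists_congr fun x => forall_congr' fun r => iff_of_eq (congrArg _ ?_)
      funext q
      rcases q with q | q <;> rfl
    obtain ⟨j, hj, h1⟩ := hfa k θ (t.orderEmbOfFin hsk) (t.orderEmbOfFin hsk).strictMono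
      ((hθ fun r => f (t.orderEmbOfFin hsk r)).2
        ⟨x, fun r => hx _ (Finset.mem_image_of_mem f (t.orderEmbOfFin_mem hsk r))⟩)
    obtain ⟨y, hy⟩ := (hθ fun r => a (j r)).1 h1
    refine hk (Finset.univ.image (a ∘ j)) ?_ ?_ ⟨y, ?_⟩
    · intro c hc
      obtain ⟨r, -, rfl⟩ := Finset.mem_image.1 (Finset.mem_coe.1 hc)
      exact haK _
    · rw [Finset.card_image_of_injective _ (ha.comp hj), Finset.card_fin]
    · intro c hc
      obtain ⟨r, -, rfl⟩ := Finset.mem_image.1 hc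
      exact hy r

theorem fRealize_instFormula {m n : ℕ} (φ : L.Formula (Fin m ⊕ Fin n)) (a : Fin n → U)
    (x : Fin m → U) :
    FRealize U (addAllConsts U iS) (instFormula L U φ a) x ↔ φ.Realize (Sum.elim x a) := by
  let _ : (L[[U]]).Structure U := addAllConsts U iS
  have : (L.lhomWithConstants U).IsExpansionOn U := ⟨fun _ _ => rfl, fun _ _ => rfl⟩
  refine BoundedFormula.realize_subst.trans ?_
  refine (LHom.realize_onBoundedFormula (L.lhomWithConstants U) φ).trans ?_
  refine iff_of_eq (congrArg (fun v => φ.Realize v) ?_)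
  funext q
  rcases q with q | q <;> rfl

theorem isGlobalType_setOf_fRealize {m : ℕ} (x : Fin m → U) :
    IsGlobalType L U {ψ : (L[[U]]).Formula (Fin m) | FRealize U (addAllConsts U iS) ψ x} :=
  ⟨fun _ hs => ⟨x, fun _ hψ => hs hψ⟩, fun _ => not_not.symm⟩

end Saturation

/-- `φ(x,b)` does not divide over `A` iff the family of externally definable
sets of sort `φ(x,z)` locally covers the orbit `o(b/A)`. -/
theorem stmt16 (L : FirstOrder.Language.{u, u}) (U : Type u) [iS : L.Structure U]
    (hsat : IsSatStr U iS) (hinacc : Cardinal.IsInaccessible #U) (hcard : L.card < #U)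
    (hram : IsRamseyCard (#U))
    (m n : ℕ) (φ : L.Formula (Fin m ⊕ Fin n)) (b : Fin n → U)
    (A : Set U) (hA : #A < #U) :
    (¬Divides L U φ b A ↔
      LocallyCovers (#U)
        {E : Set (Fin n → U) | ∃ p : Set ((L[[U]]).Formula (Fin m)),
          IsGlobalType L U p ∧ E = {a | instFormula L U φ a ∈ p}}
        (oTuple L U A b)) := by
  constructor
  · intro hdiv K hK hKU k
    have hinf : K.Infinite := by
      rw [← Set.infinite_coe_iff, Cardinal.infinite_iff, hKU]
      exact hinacc.aleph0_lt.le
    have hcons : ∃ s : Finset (Fin n → U), ↑s ⊆ K ∧ s.card = k ∧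
        ∃ x : Fin m → U, ∀ c ∈ s, φ.Realize (Sum.elim x c) := by
      by_contra hn
      exact hdiv ⟨K, hK, hinf, k, fun s hs hsk hx => hn ⟨s, hs, hsk, hx⟩⟩
    obtain ⟨s, hs, rfl, x, hx⟩ := hcons
    refine ⟨_, ⟨_, isGlobalType_setOf_fRealize x, rfl⟩, ?_⟩
    rw [← Cardinal.mk_coe_finset]
    exact mk_le_mk_of_subset fun c hc => ⟨hs hc, (fRealize_instFormula φ c x).2 (hx c hc)⟩
  · intro hcov hdiv
    classical
    obtain ⟨K, hK, hKU, k, hk⟩ := hdiv.exists_card_eq hsat hinacc.aleph0_lt hA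
    obtain ⟨_, ⟨p, hp, rfl⟩, hcard'⟩ := hcov K hK hKU k
    obtain ⟨t, ht⟩ := exists_finset_le_card _ k hcard'
    obtain ⟨s, hst, hsk⟩ := Finset.exists_subset_card_eq ht
    refine hk (s.map (Function.Embedding.subtype _)) ?_ (by rw [Finset.card_map, hsk]) ?_
    · intro c hc
      obtain ⟨c, -, rfl⟩ := Finset.mem_map.1 (Finset.mem_coe.1 hc)
      exact c.2.1
    · obtain ⟨x, hx⟩ := hp.1 (s.image fun c => instFormula L U φ c.1) (by
        intro ψ hψ
        obtain ⟨c, -, rfl⟩ := Finset.mem_image.1 (Finset.mem_coe.1 hψ)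
        exact c.2.2)
      refine ⟨x, fun c hc => ?_⟩
      obtain ⟨c, hcs, rfl⟩ := Finset.mem_map.1 hc
      exact (fRealize_instFormula φ c.1 x).1 (hx _ (Finset.mem_image_of_mem _ hcs))

end Paper
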